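/- For each r ∈ (0, 1/36), the set 𝒦_r of pairs (p,q) ∈ (0,r)² for which the system S_pqr has unique one-point intersection (i.e. K_3 ∩ K_4 = {h}) has full two-dimensional Lebesgue measure in (0,r)²; moreover, for each fixed p ∈ (0,r), the set of q ∈ (0,r) with (p,q) ∈ 𝒦_r has full one-dimensional Lebesgue measure in (0,r). -/

import Mathlib

open Set MeasureTheory

/-- The system `S_pqr = {S_1,…,S_6}` of similarities of `ℝ` (0-indexed: index `i : Fin 6`
corresponds to `S_{i+1}`), with `a = 1/5` and `h = 8/15`. -/
noncomputable def Spqr (p q r : ℝ) : Fin 6 → ℝ → ℝ :=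
  ![fun x => p * x,
    fun x => 1/5 + r * x,
    fun x => 8/15 - q * x,
    fun x => 8/15 - r + r * x,
    fun x => 1 - 1/5 - r * x,
    fun x => 1 - r + r * x]

/-- `K` is the attractor of the system `T`. -/
def IsAttractor (T : Fin 6 → ℝ → ℝ) (K : Set ℝ) : Prop :=
  K.Nonempty ∧ IsCompact K ∧ K = ⋃ i, T i '' K

/-- `S_pqr` (with attractor `K`) has unique one-point intersection:
`K₃ ∩ K₄ = {8/15}` (indices `2, 3` here) and all other pairwise intersections of
distinct pieces are empty. -/
def UniqueOnePointIntersection (p q r : ℝ) (K : Set ℝ) : Prop :=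
  (Spqr p q r 2 '' K) ∩ (Spqr p q r 3 '' K) = {8/15} ∧
    ∀ i j : Fin 6, i ≠ j → ({i, j} : Set (Fin 6)) ≠ {2, 3} →
      (Spqr p q r i '' K) ∩ (Spqr p q r j '' K) = ∅

section Pieces

variable {p q r : ℝ}

lemma Spqr_mem_Icc (hp : p ∈ Ioo 0 r) (hq : q ∈ Ioo 0 r) (hr : r < 1 / 36) (i : Fin 6) {x : ℝ}
    (hx : x ∈ Icc (0 : ℝ) 1) : Spqr p q r i x ∈ Icc (0 : ℝ) 1 := by
  obtain ⟨hp0, hpr⟩ := hp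
  obtain ⟨hq0, hqr⟩ := hq
  obtain ⟨hx0, hx1⟩ := hx
  have hr0 : 0 < r := hp0.trans hpr
  have h1 : p * x ≤ p := mul_le_of_le_one_right hp0.le hx1
  have h2 : q * x ≤ q := mul_le_of_le_one_right hq0.le hx1
  have h3 : r * x ≤ r := mul_le_of_le_one_right hr0.le hx1
  have h4 : 0 ≤ p * x := by positivity
  have h5 : 0 ≤ q * x := by positivity
  have h6 : 0 ≤ r * x := by positivity
  fin_cases i <;> simp [Spqr] <;> constructor <;> linarith

lemma abs_Spqr_sub_le (hp : p ∈ Ioo 0 r) (hq : q ∈ Ioo 0 r) (i : Fin 6) (x y : ℝ) :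
    |Spqr p q r i x - Spqr p q r i y| ≤ r * |x - y| := by
  obtain ⟨hp0, hpr⟩ := hp
  obtain ⟨hq0, hqr⟩ := hq
  have hr0 : 0 < r := hp0.trans hpr
  have key : ∀ c, |c| ≤ r → Spqr p q r i x - Spqr p q r i y = c * (x - y) →
      |Spqr p q r i x - Spqr p q r i y| ≤ r * |x - y| := by
    intro c hc h
    rw [h, abs_mul]
    exact mul_le_mul_of_nonneg_right hc (abs_nonneg _)
  fin_cases i
  · exact key p (by rw [abs_of_pos hp0]; exact hpr.le) (by simp [Spqr]; ring)
  · exact key r (abs_of_pos hr0).le (by simp [Spqr]; ring)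
  · exact key (-q) (by rw [abs_neg, abs_of_pos hq0]; exact hqr.le) (by simp [Spqr]; ring)
  · exact key r (abs_of_pos hr0).le (by simp [Spqr]; ring)
  · exact key (-r) (by rw [abs_neg, abs_of_pos hr0]) (by simp [Spqr]; ring)
  · exact key r (abs_of_pos hr0).le (by simp [Spqr]; ring)

/-- The image of `0` under the composition of the similarities indexed by a word. -/
noncomputable def wordPoint (p q r : ℝ) : (n : ℕ) → (Fin n → Fin 6) → ℝ
  | 0, _ => 0
  | n + 1, w => Spqr p q r (w 0) (wordPoint p q r n (fun j => w j.succ))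

lemma wordPoint_mem_Icc (hp : p ∈ Ioo 0 r) (hq : q ∈ Ioo 0 r) (hr : r < 1 / 36) (n : ℕ)
    (w : Fin n → Fin 6) : wordPoint p q r n w ∈ Icc (0 : ℝ) 1 := by
  induction n with
  | zero => simp [wordPoint]
  | succ n ih => exact Spqr_mem_Icc hp hq hr _ (ih _)

lemma abs_Spqr_sub_Spqr_le {q' : ℝ} (hp : p ∈ Ioo 0 r) (hq : q ∈ Ioo 0 r) (i : Fin 6) {x y : ℝ}
    (hy : y ∈ Icc (0 : ℝ) 1) :
    |Spqr p q r i x - Spqr p q' r i y| ≤ r * |x - y| + |q - q'| := by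
  have h1 := abs_Spqr_sub_le hp hq i x y
  have h2 : |Spqr p q r i y - Spqr p q' r i y| ≤ |q - q'| := by
    by_cases hi : i = 2
    · subst hi
      have : Spqr p q r 2 y - Spqr p q' r 2 y = -((q - q') * y) := by simp [Spqr]; ring
      rw [this, abs_neg, abs_mul, abs_of_nonneg hy.1]
      exact mul_le_of_le_one_right (abs_nonneg _) hy.2
    · have : Spqr p q r i y - Spqr p q' r i y = 0 := by
        fin_cases i <;> simp [Spqr] at hi ⊢
      rw [this, abs_zero]
      exact abs_nonneg _
  exact (abs_sub_le _ (Spqr p q r i y) _).trans (add_le_add h1 h2)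

lemma abs_wordPoint_sub_le {q' : ℝ} (hp : p ∈ Ioo 0 r) (hq : q ∈ Ioo 0 r) (hq' : q' ∈ Ioo 0 r)
    (hr : r < 1 / 36) (n : ℕ) (w : Fin n → Fin 6) :
    |wordPoint p q r n w - wordPoint p q' r n w| ≤ 36 / 35 * |q - q'| := by
  induction n with
  | zero => simp [wordPoint]
  | succ n ih =>
    have h1 := abs_Spqr_sub_Spqr_le (q' := q') hp hq (w 0)
      (x := wordPoint p q r n fun j => w j.succ)
      (wordPoint_mem_Icc hp hq' hr n fun j => w j.succ)
    have h2 := ih fun j => w j.succ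
    have h3 := mul_le_mul hr.le h2 (abs_nonneg _) (by norm_num)
    simp only [wordPoint]
    linarith

lemma continuous_wordPoint (r : ℝ) (n : ℕ) (w : Fin n → Fin 6) :
    Continuous fun z : ℝ × ℝ => wordPoint z.1 z.2 r n w := by
  induction n with
  | zero => simp only [wordPoint]; fun_prop
  | succ n ih =>
    have h := ih fun j => w j.succ
    simp only [wordPoint]
    generalize w 0 = i
    fin_cases i <;> simp only [Spqr] <;> simp <;> fun_prop

end Pieces

section Attractor

variable {p q r : ℝ} {K : Set ℝ}

lemma IsAttractor.Spqr_mem (hK : IsAttractor (Spqr p q r) K) (i : Fin 6) {x : ℝ} (hx : x ∈ K) :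
    Spqr p q r i x ∈ K := by
  rw [hK.2.2]
  exact mem_iUnion.2 ⟨i, mem_image_of_mem _ hx⟩

lemma IsAttractor.exists_eq_Spqr (hK : IsAttractor (Spqr p q r) K) {x : ℝ} (hx : x ∈ K) :
    ∃ i, ∃ y ∈ K, x = Spqr p q r i y := by
  rw [hK.2.2] at hx
  obtain ⟨i, y, hy, h⟩ := mem_iUnion.1 hx
  exact ⟨i, y, hy, h.symm⟩

lemma IsAttractor.subset_Icc (hp : p ∈ Ioo 0 r) (hq : q ∈ Ioo 0 r) (hr : r < 1 / 36)
    (hK : IsAttractor (Spqr p q r) K) : K ⊆ Icc 0 1 := by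
  obtain ⟨x, hx, hmax⟩ := hK.2.1.exists_isMaxOn hK.1
    (f := fun x : ℝ => |x - 1 / 2|) (by fun_prop)
  obtain ⟨i, y, hy, hxy⟩ := hK.exists_eq_Spqr hx
  have hyx : |y - 1 / 2| ≤ |x - 1 / 2| := hmax hy
  have hbound : |x - 1 / 2| ≤ 1 / 2 := by
    obtain ⟨hp0, hpr⟩ := hp
    obtain ⟨hq0, hqr⟩ := hq
    have hr0 : 0 < r := hp0.trans hpr
    have key : ∀ c d : ℝ, |c| ≤ r → |d| ≤ 1 / 2 - |c| / 2 → x - 1 / 2 = c * (y - 1 / 2) + d →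
        |x - 1 / 2| ≤ 1 / 2 := by
      intro c d hc hd h
      have h1 : |x - 1 / 2| ≤ |c| * |y - 1 / 2| + |d| := by
        rw [← abs_mul]
        conv_lhs => rw [h]
        exact abs_add_le _ _
      have h2 : |c| * |y - 1 / 2| ≤ |c| * |x - 1 / 2| :=
        mul_le_mul_of_nonneg_left hyx (abs_nonneg _)
      have h3 : 0 ≤ (1 - |c|) := by linarith
      by_contra! hlt
      nlinarith
    subst hxy
    fin_cases i
    · refine key p (p / 2 - 1 / 2) ?_ ?_ (by simp [Spqr]; ring) <;>
        rw [abs_of_pos hp0]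
      · exact hpr.le
      · rw [abs_le]; constructor <;> linarith
    · refine key r (1 / 5 + r / 2 - 1 / 2) ?_ ?_ (by simp [Spqr]; ring) <;>
        rw [abs_of_pos hr0]
      rw [abs_le]; constructor <;> linarith
    · refine key (-q) (8 / 15 - q / 2 - 1 / 2) ?_ ?_ (by simp [Spqr]; ring) <;>
        rw [abs_neg, abs_of_pos hq0]
      · exact hqr.le
      · rw [abs_le]; constructor <;> linarith
    · refine key r (8 / 15 - r / 2 - 1 / 2) ?_ ?_ (by simp [Spqr]; ring) <;>
        rw [abs_of_pos hr0]
      rw [abs_le]; constructor <;> linarith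
    · refine key (-r) (4 / 5 - r / 2 - 1 / 2) ?_ ?_ (by simp [Spqr]; ring) <;>
        rw [abs_neg, abs_of_pos hr0]
      rw [abs_le]; constructor <;> linarith
    · refine key r (1 - r / 2 - 1 / 2) ?_ ?_ (by simp [Spqr]; ring) <;>
        rw [abs_of_pos hr0]
      rw [abs_le]; constructor <;> linarith
  intro z hz
  have h : |z - 1 / 2| ≤ 1 / 2 := (hmax hz).trans hbound
  rw [abs_le] at h
  constructor <;> linarith [h.1, h.2]

lemma IsAttractor.zero_mem (hp : p ∈ Ioo 0 r) (hq : q ∈ Ioo 0 r) (hr : r < 1 / 36)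
    (hK : IsAttractor (Spqr p q r) K) : (0 : ℝ) ∈ K := by
  obtain ⟨m, hm, hmin⟩ := hK.2.1.exists_isLeast hK.1
  have h0 := (hK.subset_Icc hp hq hr hm).1
  have h1 : m ≤ p * m := hmin (hK.Spqr_mem 0 hm)
  have h2 : m = 0 := by nlinarith [hp.1, hp.2]
  exact h2 ▸ hm

lemma IsAttractor.one_mem (hp : p ∈ Ioo 0 r) (hq : q ∈ Ioo 0 r) (hr : r < 1 / 36)
    (hK : IsAttractor (Spqr p q r) K) : (1 : ℝ) ∈ K := by
  obtain ⟨m, hm, hmax⟩ := hK.2.1.exists_isGreatest hK.1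
  have h0 := (hK.subset_Icc hp hq hr hm).2
  have h1 : 1 - r + r * m ≤ m := hmax (hK.Spqr_mem 5 hm)
  have h2 : m = 1 := by nlinarith [hp.1, hp.2]
  exact h2 ▸ hm

lemma IsAttractor.exists_wordPoint (hp : p ∈ Ioo 0 r) (hq : q ∈ Ioo 0 r) (hr : r < 1 / 36)
    (hK : IsAttractor (Spqr p q r) K) (n : ℕ) {x : ℝ} (hx : x ∈ K) :
    ∃ w, |x - wordPoint p q r n w| ≤ r ^ n := by
  induction n generalizing x with
  | zero =>
    refine ⟨finZeroElim, ?_⟩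
    have h := hK.subset_Icc hp hq hr hx
    simp only [wordPoint, sub_zero, pow_zero, abs_of_nonneg h.1]
    exact h.2
  | succ n ih =>
    obtain ⟨i, y, hy, rfl⟩ := hK.exists_eq_Spqr hx
    obtain ⟨w, hw⟩ := ih hy
    refine ⟨Fin.cons i w, ?_⟩
    simp only [wordPoint, Fin.cons_zero, Fin.cons_succ]
    refine (abs_Spqr_sub_le hp hq i _ _).trans ?_
    rw [pow_succ']
    exact mul_le_mul_of_nonneg_left hw (hp.1.trans hp.2).le

lemma IsAttractor.one_fifth_le_or (hp : p ∈ Ioo 0 r) (hq : q ∈ Ioo 0 r) (hr : r < 1 / 36)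
    (hK : IsAttractor (Spqr p q r) K) {x : ℝ} (hx : x ∈ K) :
    1 / 5 ≤ x ∨ ∃ y ∈ K, x = p * y := by
  obtain ⟨i, y, hy, rfl⟩ := hK.exists_eq_Spqr hx
  have hy01 := hK.subset_Icc hp hq hr hy
  obtain ⟨hq0, hqr⟩ := hq
  have hr0 : 0 < r := hp.1.trans hp.2
  have h2 : q * y ≤ q := mul_le_of_le_one_right hq0.le hy01.2
  have h3 : r * y ≤ r := mul_le_of_le_one_right hr0.le hy01.2
  have h6 : 0 ≤ r * y := mul_nonneg hr0.le hy01.1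
  by_cases hi : i = 0
  · subst hi
    exact Or.inr ⟨y, hy, rfl⟩
  · left
    fin_cases i <;> simp [Spqr] at hi ⊢ <;> linarith

lemma IsAttractor.le_four_fifths_or (hp : p ∈ Ioo 0 r) (hq : q ∈ Ioo 0 r) (hr : r < 1 / 36)
    (hK : IsAttractor (Spqr p q r) K) {x : ℝ} (hx : x ∈ K) :
    1 / 5 ≤ 1 - x ∨ ∃ y ∈ K, 1 - x = r * (1 - y) := by
  obtain ⟨i, y, hy, rfl⟩ := hK.exists_eq_Spqr hx
  have hy01 := hK.subset_Icc hp hq hr hy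
  have hr0 : 0 < r := hp.1.trans hp.2
  have h1 : p * y ≤ p := mul_le_of_le_one_right hp.1.le hy01.2
  have h3 : r * y ≤ r := mul_le_of_le_one_right hr0.le hy01.2
  have h5 : 0 ≤ q * y := mul_nonneg hq.1.le hy01.1
  have h6 : 0 ≤ r * y := mul_nonneg hr0.le hy01.1
  have hpr := hp.2
  by_cases hi : i = 5
  · subst hi
    exact Or.inr ⟨y, hy, by simp [Spqr]; ring⟩
  · left
    fin_cases i <;> simp [Spqr] at hi ⊢ <;> linarith

lemma IsAttractor.exists_eq_pow_mul (hp : p ∈ Ioo 0 r) (hq : q ∈ Ioo 0 r) (hr : r < 1 / 36)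
    (hK : IsAttractor (Spqr p q r) K) {x : ℝ} (hx : x ∈ K) (hx0 : 0 < x) :
    ∃ k, ∃ y ∈ K, x = p ^ k * y ∧ 1 / 5 ≤ y := by
  obtain ⟨n, hn⟩ := exists_pow_lt_of_lt_one hx0 (show p < 1 by linarith [hp.2])
  induction n generalizing x with
  | zero => exact absurd hn (by simpa using (hK.subset_Icc hp hq hr hx).2)
  | succ n ih =>
    obtain h | ⟨y, hy, rfl⟩ := hK.one_fifth_le_or hp hq hr hx
    · exact ⟨0, x, hx, by simp, h⟩
    · rw [pow_succ'] at hn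
      obtain ⟨k, z, hz, rfl, h⟩ := ih hy (pos_of_mul_pos_right hx0 hp.1.le)
        (lt_of_mul_lt_mul_left hn hp.1.le)
      exact ⟨k + 1, z, hz, by ring, h⟩

lemma IsAttractor.exists_one_sub_eq_pow_mul (hp : p ∈ Ioo 0 r) (hq : q ∈ Ioo 0 r)
    (hr : r < 1 / 36) (hK : IsAttractor (Spqr p q r) K) {x : ℝ} (hx : x ∈ K) (hx0 : 0 < 1 - x) :
    ∃ l, ∃ y ∈ K, 1 - x = r ^ l * (1 - y) ∧ 1 / 5 ≤ 1 - y := by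
  have hr0 : 0 < r := hp.1.trans hp.2
  obtain ⟨n, hn⟩ := exists_pow_lt_of_lt_one hx0 (show r < 1 by linarith)
  induction n generalizing x with
  | zero =>
    have := (hK.subset_Icc hp hq hr hx).1
    rw [pow_zero] at hn
    linarith
  | succ n ih =>
    obtain h | ⟨y, hy, hxy⟩ := hK.le_four_fifths_or hp hq hr hx
    · exact ⟨0, x, hx, by simp, h⟩
    · rw [pow_succ', hxy] at hn
      rw [hxy] at hx0
      obtain ⟨l, z, hz, h1, h2⟩ := ih hy (pos_of_mul_pos_right hx0 hr0.le)
        (lt_of_mul_lt_mul_left hn hr0.le)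
      exact ⟨l + 1, z, hz, by rw [hxy, h1]; ring, h2⟩

lemma IsAttractor.image_inter_image_eq_empty (hp : p ∈ Ioo 0 r) (hq : q ∈ Ioo 0 r)
    (hr : r < 1 / 36) (hK : IsAttractor (Spqr p q r) K) {i j : Fin 6} (hij : i ≠ j)
    (h23 : ({i, j} : Set (Fin 6)) ≠ {2, 3}) :
    (Spqr p q r i '' K) ∩ (Spqr p q r j '' K) = ∅ := by
  rw [eq_empty_iff_forall_notMem]
  rintro _ ⟨⟨x, hx, rfl⟩, y, hy, hxy⟩
  have h1 : ¬(i = 2 ∧ j = 3) := by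
    rintro ⟨rfl, rfl⟩
    exact h23 rfl
  have h2 : ¬(i = 3 ∧ j = 2) := by
    rintro ⟨rfl, rfl⟩
    exact h23 (pair_comm _ _)
  clear h23
  have hr0 : 0 < r := hp.1.trans hp.2
  have bounds : ∀ z ∈ K, 0 ≤ p * z ∧ p * z ≤ p ∧ 0 ≤ q * z ∧ q * z ≤ q ∧ 0 ≤ r * z ∧
      r * z ≤ r := by
    intro z hz
    obtain ⟨h0, h1⟩ := hK.subset_Icc hp hq hr hz
    exact ⟨mul_nonneg hp.1.le h0, mul_le_of_le_one_right hp.1.le h1, mul_nonneg hq.1.le h0,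
      mul_le_of_le_one_right hq.1.le h1, mul_nonneg hr0.le h0, mul_le_of_le_one_right hr0.le h1⟩
  have hbx := bounds x hx
  have hby := bounds y hy
  obtain ⟨hp0, hpr⟩ := hp
  obtain ⟨hq0, hqr⟩ := hq
  fin_cases i <;> fin_cases j <;> simp [Spqr] at hij h1 h2 hxy <;> linarith

lemma IsAttractor.exists_of_not_unique (hp : p ∈ Ioo 0 r) (hq : q ∈ Ioo 0 r) (hr : r < 1 / 36)
    (hK : IsAttractor (Spqr p q r) K) (h : ¬ UniqueOnePointIntersection p q r K) :
    ∃ k l : ℕ, ∃ x ∈ K, ∃ y ∈ K, 1 / 5 ≤ x ∧ 1 / 5 ≤ 1 - y ∧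
      q * p ^ k * x = r ^ (l + 1) * (1 - y) := by
  contrapose! h
  refine ⟨subset_antisymm ?_ ?_, fun i j hij h23 =>
    hK.image_inter_image_eq_empty hp hq hr hij h23⟩
  · rintro _ ⟨⟨x, hx, rfl⟩, y, hy, hxy⟩
    have hxy' : q * x = r * (1 - y) := by simp [Spqr] at hxy; linarith
    have hr0 : 0 < r := hp.1.trans hp.2
    obtain hx0 | hx0 := (hK.subset_Icc hp hq hr hx).1.eq_or_lt
    · simp [Spqr, ← hx0]
    · have hy1 : 0 < 1 - y := by
        refine pos_of_mul_pos_right ?_ hr0.le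
        rw [← hxy']
        exact mul_pos hq.1 hx0
      obtain ⟨k, x', hx', rfl, hx5⟩ := hK.exists_eq_pow_mul hp hq hr hx hx0
      obtain ⟨l, y', hy', hyy, hy5⟩ := hK.exists_one_sub_eq_pow_mul hp hq hr hy hy1
      refine absurd ?_ (h k l x' hx' y' hy' hx5 hy5)
      rw [hyy] at hxy'
      linear_combination hxy'
  · rintro _ rfl
    exact ⟨⟨0, hK.zero_mem hp hq hr, by simp [Spqr]⟩, 1, hK.one_mem hp hq hr, by simp [Spqr]⟩

end Attractor

section Resonance

variable {p r : ℝ}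

/-- The parameters `(p, q)` at which `q p ^ k x - r ^ (l + 1) (1 - y)` almost vanishes, where `x`
and `y` are the points coded by the words `v` and `w`, away from `0` and `1` respectively. -/
def wordResonance (r : ℝ) (k l n : ℕ) (v w : Fin n → Fin 6) : Set (ℝ × ℝ) :=
  {z | |z.2 * z.1 ^ k * wordPoint z.1 z.2 r n v - r ^ (l + 1) * (1 - wordPoint z.1 z.2 r n w)|
      ≤ 2 * r ^ n ∧ 1 / 6 ≤ wordPoint z.1 z.2 r n v ∧ 1 / 6 ≤ 1 - wordPoint z.1 z.2 r n w}

/-- A Borel set containing the parameters `(p, q)` at which `q p ^ k x = r ^ (l + 1) (1 - y)` for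
some points `x`, `y` of the attractor with `1 / 5 ≤ x` and `y ≤ 4 / 5`. -/
def resonance (r : ℝ) (k l : ℕ) : Set (ℝ × ℝ) :=
  ⋂ n : ℕ, ⋃ vw : (Fin (n + 1) → Fin 6) × (Fin (n + 1) → Fin 6),
    wordResonance r k l (n + 1) vw.1 vw.2

lemma measurableSet_resonance (r : ℝ) (k l : ℕ) : MeasurableSet (resonance r k l) := by
  refine MeasurableSet.iInter fun n => MeasurableSet.iUnion fun vw => IsClosed.measurableSet ?_
  have h1 := continuous_wordPoint r (n + 1) vw.1
  have h2 := continuous_wordPoint r (n + 1) vw.2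
  refine IsClosed.and ?_ (IsClosed.and ?_ ?_)
  · exact isClosed_le (by fun_prop) (by fun_prop)
  · exact isClosed_le (by fun_prop) (by fun_prop)
  · exact isClosed_le (by fun_prop) (by fun_prop)

lemma mem_resonance {q : ℝ} {K : Set ℝ} (hp : p ∈ Ioo 0 r) (hq : q ∈ Ioo 0 r) (hr : r < 1 / 36)
    (hK : IsAttractor (Spqr p q r) K) {k l : ℕ} {x y : ℝ} (hx : x ∈ K) (hy : y ∈ K)
    (hx5 : 1 / 5 ≤ x) (hy5 : 1 / 5 ≤ 1 - y) (h : q * p ^ k * x = r ^ (l + 1) * (1 - y)) :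
    (p, q) ∈ resonance r k l := by
  refine mem_iInter.2 fun n => ?_
  obtain ⟨v, hv⟩ := hK.exists_wordPoint hp hq hr (n + 1) hx
  obtain ⟨w, hw⟩ := hK.exists_wordPoint hp hq hr (n + 1) hy
  refine mem_iUnion.2 ⟨(v, w), ?_⟩
  have hr0 : 0 < r := hp.1.trans hp.2
  have hrn : r ^ (n + 1) ≤ r := pow_le_of_le_one hr0.le (by linarith) n.succ_ne_zero
  have hv' := abs_le.1 hv
  have hw' := abs_le.1 hw
  refine ⟨?_, by dsimp only; linarith, by dsimp only; linarith⟩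
  dsimp only
  have hA0 : 0 ≤ q * p ^ k := mul_nonneg hq.1.le (pow_nonneg hp.1.le _)
  have hA1 : q * p ^ k ≤ 1 :=
    mul_le_one₀ (by linarith [hq.2]) (pow_nonneg hp.1.le _)
      (pow_le_one₀ hp.1.le (by linarith [hp.2]))
  have hB0 : 0 ≤ r ^ (l + 1) := by positivity
  have hB1 : r ^ (l + 1) ≤ 1 := pow_le_one₀ hr0.le (by linarith)
  have e : q * p ^ k * wordPoint p q r (n + 1) v - r ^ (l + 1) * (1 - wordPoint p q r (n + 1) w)
      = -(q * p ^ k * (x - wordPoint p q r (n + 1) v)) -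
        r ^ (l + 1) * (y - wordPoint p q r (n + 1) w) := by
    linear_combination h
  rw [e]
  refine (abs_sub _ _).trans ?_
  rw [abs_neg, abs_mul (q * p ^ k), abs_mul (r ^ (l + 1)), abs_of_nonneg hA0, abs_of_nonneg hB0]
  have h1 := mul_le_mul hA1 hv (abs_nonneg _) zero_le_one
  have h2 := mul_le_mul hB1 hw (abs_nonneg _) zero_le_one
  linarith

/-- Transversality: the almost-resonant parameters `q` of a pair of words of length `n` lie
within a distance of order `r ^ n` of each other. -/
lemma sub_le_of_mem_wordResonance {q q' : ℝ} (hp : p ∈ Ioo 0 r) (hr : r < 1 / 36) {k l n : ℕ}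
    {v w : Fin n → Fin 6} (hq : q ∈ Ioo 0 r) (hq' : q' ∈ Ioo 0 r)
    (h : (p, q) ∈ wordResonance r k l n v w) (h' : (p, q') ∈ wordResonance r k l n v w)
    (hqq' : q ≤ q') : q' - q ≤ 400 * r ^ n / p ^ k := by
  obtain ⟨h1, h2, h3⟩ := h
  obtain ⟨h1', h2', h3'⟩ := h'
  dsimp only at h1 h2 h3 h1' h2' h3'
  have hu := abs_wordPoint_sub_le hp hq' hq hr n v
  have hv := abs_wordPoint_sub_le hp hq' hq hr n w
  have hv1 := (wordPoint_mem_Icc hp hq hr n w).1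
  have hv1' := (wordPoint_mem_Icc hp hq' hr n w).1
  have hu1 := (wordPoint_mem_Icc hp hq hr n v).2
  have hu1' := (wordPoint_mem_Icc hp hq' hr n v).2
  have hA : 0 < p ^ k := pow_pos hp.1 _
  have hB : 0 ≤ r ^ n := pow_nonneg (hp.1.trans hp.2).le _
  rw [abs_of_nonneg (sub_nonneg.2 hqq')] at hu hv
  obtain ⟨hq0, hqr⟩ := hq
  obtain ⟨hq0', hqr'⟩ := hq'
  generalize wordPoint p q r n v = u at *
  generalize wordPoint p q' r n v = u' at *
  obtain ⟨y, hy⟩ : ∃ y, y = 1 - wordPoint p q r n w := ⟨_, rfl⟩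
  obtain ⟨y', hy'⟩ : ∃ y', y' = 1 - wordPoint p q' r n w := ⟨_, rfl⟩
  have hyy : |y' - y| ≤ 36 / 35 * (q' - q) := by
    rw [hy, hy', abs_sub_comm]
    convert hv using 2
    ring
  have hy1 : y ≤ 1 := by linarith
  have hy1' : y' ≤ 1 := by linarith
  rw [← hy] at h1 h3
  rw [← hy'] at h1' h3'
  clear hv hv1 hv1' hy hy'
  generalize r ^ (l + 1) = B at *
  generalize p ^ k = A at *
  obtain ⟨d, hd⟩ : ∃ d, d = q' - q := ⟨_, rfl⟩
  have hd0 : 0 ≤ d := by linarith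
  rw [← hd] at hu hyy ⊢
  have cross : A * (q' * u' * y - q * u * y') ≤ 4 * r ^ n := by
    have e : A * (q' * u' * y - q * u * y') =
        y * (q' * A * u' - B * y') - y' * (q * A * u - B * y) := by ring
    have i1 : y * (q' * A * u' - B * y') ≤ 1 * (2 * r ^ n) :=
      mul_le_mul_of_nonneg hy1 (abs_le.1 h1').2 (by linarith) (by linarith)
    have i2 : y' * -(q * A * u - B * y) ≤ 1 * (2 * r ^ n) :=
      mul_le_mul_of_nonneg hy1' (by linarith [(abs_le.1 h1).1]) (by linarith) (by linarith)
    rw [e]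
    linarith
  have lower : d / 100 ≤ q' * u' * y - q * u * y' := by
    have e : q' * u' * y - q * u * y' = d * (u' * y) + q * ((u' - u) * y + u * (y - y')) := by
      rw [hd]; ring
    have i1 : -(36 / 35 * d * y) ≤ (u' - u) * y := by
      nlinarith [(abs_le.1 hu).1]
    have i2 : -(36 / 35 * d * u) ≤ u * (y - y') := by
      nlinarith [(abs_le.1 hyy).2]
    have i3 : -(1 / 35 * d * (y + u)) ≤ q * ((u' - u) * y + u * (y - y')) := by
      have j1 : q * -(36 / 35 * d * (y + u)) ≤ q * ((u' - u) * y + u * (y - y')) :=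
        mul_le_mul_of_nonneg_left (by linarith) hq0.le
      have j2 : q * (36 / 35 * d * (y + u)) ≤ 1 / 36 * (36 / 35 * d * (y + u)) :=
        mul_le_mul_of_nonneg_right (by linarith)
          (mul_nonneg (by linarith) (by linarith))
      linarith
    have i4 : u ≤ u' + 1 / 35 := by linarith [(abs_le.1 hu).1]
    have i5 : 1 / 100 + 1 / 35 * (y + u) ≤ u' * y := by nlinarith
    have i6 := mul_le_mul_of_nonneg_left i5 hd0
    rw [e]
    linarith
  rw [le_div_iff₀ hA]
  have := mul_le_mul_of_nonneg_left lower hA.le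
  linarith

lemma volume_wordResonance_slice_le (hp : p ∈ Ioo 0 r) (hr : r < 1 / 36) (k l n : ℕ)
    (v w : Fin n → Fin 6) :
    volume (Ioo 0 r ∩ {q | (p, q) ∈ wordResonance r k l n v w}) ≤
      ENNReal.ofReal (400 * r ^ n / p ^ k) := by
  refine (Real.volume_le_diam _).trans (Metric.ediam_le ?_)
  rintro q ⟨hq, h⟩ q' ⟨hq', h'⟩
  rw [edist_dist]
  refine ENNReal.ofReal_le_ofReal ?_
  rw [Real.dist_eq]
  obtain hle | hle := le_total q q'
  · rw [abs_sub_comm, abs_of_nonneg (sub_nonneg.2 hle)]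
    exact sub_le_of_mem_wordResonance hp hr hq hq' h h' hle
  · rw [abs_of_nonneg (sub_nonneg.2 hle)]
    exact sub_le_of_mem_wordResonance hp hr hq' hq h' h hle

lemma volume_resonance_slice (hp : p ∈ Ioo 0 r) (hr : r < 1 / 36) (k l : ℕ) :
    volume (Ioo 0 r ∩ {q | (p, q) ∈ resonance r k l}) = 0 := by
  have hr0 : 0 < r := hp.1.trans hp.2
  have bound : ∀ n : ℕ, volume (Ioo 0 r ∩ {q | (p, q) ∈ resonance r k l}) ≤
      ENNReal.ofReal (400 / p ^ k * (36 * r) ^ (n + 1)) := by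
    intro n
    have hsub : Ioo 0 r ∩ {q | (p, q) ∈ resonance r k l} ⊆
        ⋃ vw : (Fin (n + 1) → Fin 6) × (Fin (n + 1) → Fin 6),
          Ioo 0 r ∩ {q | (p, q) ∈ wordResonance r k l (n + 1) vw.1 vw.2} := by
      rintro q ⟨hq, h⟩
      obtain ⟨vw, hvw⟩ := mem_iUnion.1 (mem_iInter.1 h n)
      exact mem_iUnion.2 ⟨vw, hq, hvw⟩
    refine (measure_mono hsub).trans ((measure_iUnion_fintype_le _ _).trans ?_)
    refine (Finset.sum_le_sum fun vw _ =>
      volume_wordResonance_slice_le hp hr k l (n + 1) vw.1 vw.2).trans (le_of_eq ?_)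
    have h36 : (6 : ℝ) ^ (n + 1) * 6 ^ (n + 1) = 36 ^ (n + 1) := by
      rw [← mul_pow]; norm_num
    rw [Finset.sum_const, ← ENNReal.ofReal_nsmul]
    simp only [Finset.card_univ, Fintype.card_prod, Fintype.card_fun, Fintype.card_fin,
      nsmul_eq_mul, Nat.cast_mul, Nat.cast_pow, Nat.cast_ofNat]
    rw [h36, mul_pow]
    congr 1
    ring
  have lim : Filter.Tendsto (fun n : ℕ => ENNReal.ofReal (400 / p ^ k * (36 * r) ^ (n + 1)))
      Filter.atTop (nhds 0) := by
    rw [← ENNReal.ofReal_zero, ← mul_zero (400 / p ^ k)]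
    refine ENNReal.tendsto_ofReal (Filter.Tendsto.const_mul _ ?_)
    exact (tendsto_pow_atTop_nhds_zero_of_lt_one (by positivity) (by linarith)).comp
      (Filter.tendsto_add_atTop_nat 1)
  exact le_antisymm (ge_of_tendsto' lim bound) bot_le

end Resonance

/-- For each `r ∈ (0,1/36)`, the set `𝒦_r` of pairs `(p,q) ∈ (0,r)²` for which `S_pqr` has
unique one-point intersection has full planar Lebesgue measure in `(0,r)²`; moreover for
each fixed `p ∈ (0,r)` its `p`-slice has full linear Lebesgue measure in `(0,r)`. -/
theorem stmt15 (r : ℝ) (hr : r ∈ Ioo (0:ℝ) (1/36))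
    (K : ℝ → ℝ → Set ℝ)
    (hK : ∀ p ∈ Ioo (0:ℝ) (1/36), ∀ q ∈ Ioo (0:ℝ) (1/36),
      IsAttractor (Spqr p q r) (K p q)) :
    volume ((Ioo (0:ℝ) r ×ˢ Ioo (0:ℝ) r) \
        {pq : ℝ × ℝ | UniqueOnePointIntersection pq.1 pq.2 r (K pq.1 pq.2)}) = 0 ∧
    ∀ p ∈ Ioo (0:ℝ) r,
      volume (Ioo (0:ℝ) r \ {q : ℝ | UniqueOnePointIntersection p q r (K p q)}) = 0 := by
  obtain ⟨-, hr36⟩ := hr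
  have hbad : ∀ p ∈ Ioo (0:ℝ) r, ∀ q ∈ Ioo (0:ℝ) r,
      ¬ UniqueOnePointIntersection p q r (K p q) → (p, q) ∈ ⋃ k, ⋃ l, resonance r k l := by
    intro p hp q hq h
    have hA := hK p ⟨hp.1, hp.2.trans hr36⟩ q ⟨hq.1, hq.2.trans hr36⟩
    obtain ⟨k, l, x, hx, y, hy, hx5, hy5, hxy⟩ := hA.exists_of_not_unique hp hq hr36 h
    exact mem_iUnion₂.2 ⟨k, l, mem_resonance hp hq hr36 hA hx hy hx5 hy5 hxy⟩
  have hslice : ∀ p ∈ Ioo (0:ℝ) r,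
      volume (Ioo (0:ℝ) r ∩ {q | (p, q) ∈ ⋃ k, ⋃ l, resonance r k l}) = 0 := by
    intro p hp
    have e : Ioo (0:ℝ) r ∩ {q | (p, q) ∈ ⋃ k, ⋃ l, resonance r k l} =
        ⋃ k, ⋃ l, Ioo (0:ℝ) r ∩ {q | (p, q) ∈ resonance r k l} := by
      ext q
      simp
    rw [e]
    exact measure_iUnion_null fun k => measure_iUnion_null fun l =>
      volume_resonance_slice hp hr36 k l
  constructor
  · have hsub : (Ioo (0:ℝ) r ×ˢ Ioo (0:ℝ) r) \
        {pq : ℝ × ℝ | UniqueOnePointIntersection pq.1 pq.2 r (K pq.1 pq.2)} ⊆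
        (Ioo (0:ℝ) r ×ˢ Ioo (0:ℝ) r) ∩ ⋃ k, ⋃ l, resonance r k l :=
      fun z hz => ⟨hz.1, hbad z.1 hz.1.1 z.2 hz.1.2 hz.2⟩
    refine measure_mono_null hsub ?_
    rw [Measure.volume_eq_prod, Measure.measure_prod_null]
    · refine Filter.Eventually.of_forall fun p => ?_
      by_cases hp : p ∈ Ioo (0:ℝ) r
      · refine measure_mono_null ?_ (hslice p hp)
        exact fun q hq => ⟨hq.1.2, hq.2⟩
      · exact measure_mono_null (fun q hq => hp hq.1.1) measure_empty
    · exact (measurableSet_Ioo.prod measurableSet_Ioo).inter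
        (MeasurableSet.iUnion fun k => MeasurableSet.iUnion fun l => measurableSet_resonance r k l)
  · intro p hp
    refine measure_mono_null ?_ (hslice p hp)
    exact fun q hq => ⟨hq.1, hbad p hp q hq.1 hq.2⟩
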